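/- The post-swap reserve ratio is strictly increasing in the trade size: for a constant-product pool with reserves a, b > 0 and fee parameters r₁, r₂ ∈ (0,1], the output swap(a,b,δ) satisfies swap(a,b,δ) < b for all δ ≥ 0, and the function δ ↦ (a + δ)/(b − swap(a,b,δ)) is strictly increasing on [0, ∞). Consequently, if a swap of input δᶜ moves the pool's reserve ratio strictly beyond the ratio reached by a swap of input δ, then δᶜ > δ. -/

import Mathlib

/-- Constant-product AMM swap: output of swapping input `δ` through a pool with
input-side reserve `a`, output-side reserve `b` and fee parameters `r1, r2`. -/
noncomputable def swap (r1 r2 a b δ : ℝ) : ℝ := r1 * r2 * b * δ / (a + r1 * δ)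

/-- The swap output is strictly smaller than the output-side reserve. -/
theorem swap_lt_reserve {r1 r2 a b δ : ℝ} (ha : 0 < a) (hb : 0 < b) (hr1 : 0 < r1)
    (hr2 : r2 ≤ 1) (hδ : 0 ≤ δ) : swap r1 r2 a b δ < b := by
  have hden : 0 < a + r1 * δ := by positivity
  have hfee : r2 * (b * (r1 * δ)) ≤ b * (r1 * δ) := mul_le_of_le_one_left (by positivity) hr2
  rw [swap, div_lt_iff₀ hden]
  linarith [mul_pos ha hb]

/-- The swap output is monotone in the input amount. -/
theorem swap_monotoneOn {r1 r2 a b : ℝ} (ha : 0 < a) (hb : 0 < b) (hr1 : 0 < r1)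
    (hr2 : 0 < r2) : MonotoneOn (swap r1 r2 a b) (Set.Ici 0) := by
  intro x hx y hy hxy
  rw [Set.mem_Ici] at hx hy
  have hdx : 0 < a + r1 * x := by positivity
  have hdy : 0 < a + r1 * y := by positivity
  have hgap : r1 * r2 * b * a * x ≤ r1 * r2 * b * a * y := by gcongr
  rw [swap, swap, div_le_div_iff₀ hdx hdy]
  linarith

/-- the swap output stays below the output-side reserve, the
post-swap reserve ratio is strictly increasing in the trade size, and hence a
swap moving the reserve ratio strictly beyond that of another swap must have a
strictly larger input. -/
theorem post_swap_ratio_strict_mono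
    (a b r1 r2 : ℝ) (ha : 0 < a) (hb : 0 < b)
    (hr1 : 0 < r1) (hr1' : r1 ≤ 1) (hr2 : 0 < r2) (hr2' : r2 ≤ 1) :
    (∀ δ : ℝ, 0 ≤ δ → swap r1 r2 a b δ < b) ∧
    StrictMonoOn (fun δ : ℝ => (a + δ) / (b - swap r1 r2 a b δ)) (Set.Ici 0) ∧
    (∀ δ δc : ℝ, 0 ≤ δ → 0 ≤ δc →
      (a + δ) / (b - swap r1 r2 a b δ) < (a + δc) / (b - swap r1 r2 a b δc) →
      δ < δc) := by
  have hlt : ∀ δ : ℝ, 0 ≤ δ → swap r1 r2 a b δ < b := fun _ => swap_lt_reserve ha hb hr1 hr2'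
  have hmono : StrictMonoOn (fun δ : ℝ => (a + δ) / (b - swap r1 r2 a b δ)) (Set.Ici 0) := by
    intro x hx y hy hxy
    exact div_lt_div₀ (by gcongr) (sub_le_sub_left (swap_monotoneOn ha hb hr1 hr2 hx hy hxy.le) b)
      (add_nonneg ha.le hy) (sub_pos.mpr (hlt y hy))
  exact ⟨hlt, hmono, fun _ _ hδ hδc h => (hmono.lt_iff_lt hδ hδc).mp h⟩
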